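/- arXiv:2505.14348 — 3 statements merged into one kernel-verified Lean document; each statement's English description precedes it below -/
import Mathlib

section
/- Commutativity of relational Hoare triples: for every step relation R on a state type Σ, step functions fn0 fn1 : Σ → ℕ, relational conditions P Q : Set (Σ × Σ), and relational frame F : Set ((Σ × Σ) × (Σ × Σ)), ensures2 R fn0 fn1 P Q F holds if and only if ensures2 R fn1 fn0 Pˢ Qˢ Fˢ holds, where Xˢ := {(s1, s0) | (s0, s1) ∈ X} for X : Set (Σ × Σ) and Fˢ := {((s1, s0), (s1', s0')) | ((s0, s1), (s0', s1')) ∈ F}. -/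
universe u

variable {σ : Type u}

/-- n-fold composition of a step relation. -/
def relIter (R : σ → σ → Prop) : ℕ → σ → σ → Prop
  | 0, s, s' => s = s'
  | n + 1, s, s'' => ∃ s', R s s' ∧ relIter R n s' s''

/-- The `eventually` operator, defined inductively. -/
inductive EventuallyRel (R : σ → σ → Prop) (Q : Set σ) : σ → Prop
  | base {s : σ} : s ∈ Q → EventuallyRel R Q s
  | step {s : σ} : (∃ s', R s s') → (∀ s', R s s' → EventuallyRel R Q s') →
      EventuallyRel R Q s

/-- The set of states from which `Q` eventually holds. -/
def eventually (R : σ → σ → Prop) (Q : Set σ) : Set σ := {s | EventuallyRel R Q s}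

/-- The stronger eventually operator with an explicit number of steps. -/
def eventuallyN (R : σ → σ → Prop) (n : ℕ) (Q : Set σ) : Set σ :=
  {s | (∀ s', relIter R n s s' → s' ∈ Q) ∧
       (∀ l, l < n → ∀ s', relIter R l s s' → ∃ s'', R s' s'')}

/-- Ordinary unary Hoare triple. -/
def ensures (R : σ → σ → Prop) (P Q : Set σ) (F : Set (σ × σ)) : Prop :=
  ∀ s ∈ P, s ∈ eventually R {s' | s' ∈ Q ∧ (s, s') ∈ F}

/-- Stronger unary Hoare triple with a step function. -/
def ensuresN (R : σ → σ → Prop) (fn : σ → ℕ) (P Q : Set σ) (F : Set (σ × σ)) : Prop :=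
  ∀ s ∈ P, s ∈ eventuallyN R (fn s) {s' | s' ∈ Q ∧ (s, s') ∈ F}

/-- Relational Hoare triple. -/
def ensures2 (R : σ → σ → Prop) (fn0 fn1 : σ → ℕ) (P Q : Set (σ × σ))
    (F : Set ((σ × σ) × (σ × σ))) : Prop :=
  ∀ s0 s1, (s0, s1) ∈ P →
    s0 ∈ eventuallyN R (fn0 s0) {s0' | s1 ∈ eventuallyN R (fn1 s1)
      {s1' | (s0', s1') ∈ Q ∧ ((s0, s1), (s0', s1')) ∈ F}}

theorem relIter_succ_of_relIter {R : σ → σ → Prop} {n : ℕ} {s s' s'' : σ}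
    (h : relIter R n s s') (h' : R s' s'') : relIter R (n + 1) s s'' := by
  induction n generalizing s with
  | zero =>
    obtain rfl : s = s' := h
    exact ⟨s'', h', rfl⟩
  | succ n ih =>
    obtain ⟨t, hst, hts'⟩ := h
    exact ⟨t, hst, ih hts'⟩

theorem exists_relIter_of_forall_lt {R : σ → σ → Prop} {n : ℕ} {s : σ}
    (h : ∀ l, l < n → ∀ s', relIter R l s s' → ∃ s'', R s' s'') : ∃ s', relIter R n s s' := by
  induction n with
  | zero => exact ⟨s, rfl⟩
  | succ n ih =>
    obtain ⟨s', hs'⟩ := ih fun l hl => h l (hl.trans n.lt_succ_self)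
    obtain ⟨s'', hs''⟩ := h n n.lt_succ_self s' hs'
    exact ⟨s'', relIter_succ_of_relIter hs' hs''⟩

/-- Nested `eventuallyN` operators over independent executions commute. -/
theorem eventuallyN_swap {R : σ → σ → Prop} {m n : ℕ} {s t : σ} {C : σ → σ → Prop}
    (h : s ∈ eventuallyN R m {s' | t ∈ eventuallyN R n {t' | C s' t'}}) :
    t ∈ eventuallyN R n {t' | s ∈ eventuallyN R m {s' | C s' t'}} := by
  obtain ⟨s', hs'⟩ := exists_relIter_of_forall_lt h.2
  exact ⟨fun t' ht' => ⟨fun s' hs' => (h.1 s' hs').1 t' ht', h.2⟩, (h.1 s' hs').2⟩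

theorem ensures2_comm (R : σ → σ → Prop) (fn0 fn1 : σ → ℕ) (P Q : Set (σ × σ))
    (F : Set ((σ × σ) × (σ × σ))) :
    ensures2 R fn0 fn1 P Q F ↔
      ensures2 R fn1 fn0 {p | (p.2, p.1) ∈ P} {p | (p.2, p.1) ∈ Q}
        {q | ((q.1.2, q.1.1), (q.2.2, q.2.1)) ∈ F} := by
  exact ⟨fun h s1 s0 hP => eventuallyN_swap (h s0 s1 hP),
    fun h s0 s1 hP => eventuallyN_swap (h s1 s0 hP)⟩
end

section
/- Restriction rule for relational Hoare triples: for every step relation R on a state type Σ, step functions fn0 fn1 : Σ → ℕ, relational conditions P Q f : Set (Σ × Σ), and relational frame F : Set ((Σ × Σ) × (Σ × Σ)), if ensures2 R fn0 fn1 P Q F holds and f is invariant under F (i.e., for all s0 s1 s0' s1', ((s0, s1), (s0', s1')) ∈ F implies ((s0, s1) ∈ f ↔ (s0', s1') ∈ f)), then ensures2 R fn0 fn1 (P ∩ f) (Q ∩ f) F holds. -/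
universe u

variable {σ : Type u}

theorem eventuallyN_mono (R : σ → σ → Prop) (n : ℕ) {Q Q' : Set σ} (hQ : Q ⊆ Q') :
    eventuallyN R n Q ⊆ eventuallyN R n Q' :=
  fun _ hs => ⟨fun s' hs' => hQ (hs.1 s' hs'), hs.2⟩

theorem ensures2_restrict (R : σ → σ → Prop) (fn0 fn1 : σ → ℕ)
    (P Q f : Set (σ × σ)) (F : Set ((σ × σ) × (σ × σ)))
    (h : ensures2 R fn0 fn1 P Q F)
    (hf : ∀ s0 s1 s0' s1', ((s0, s1), (s0', s1')) ∈ F →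
      ((s0, s1) ∈ f ↔ (s0', s1') ∈ f)) :
    ensures2 R fn0 fn1 (P ∩ f) (Q ∩ f) F := by
  rintro s0 s1 ⟨hP, hs⟩
  refine eventuallyN_mono R _ (fun s0' h0 => ?_) (h s0 s1 hP)
  refine eventuallyN_mono R _ (fun s1' h1 => ?_) h0
  exact ⟨⟨h1.1, (hf s0 s1 s0' s1' h1.2).1 hs⟩, h1.2⟩
end

section
/- Loop rule for unary Hoare triples: for every step relation R on a state type Σ, conditions P Q : Set Σ, a frame F : Set (Σ × Σ) that is transitive (for all s s' s'', (s, s') ∈ F → (s', s'') ∈ F → (s, s'') ∈ F), a loop invariant I : ℕ → Set Σ, and a natural number k, if ensures R P (I 0) F holds, ensures R (I i) (I (i + 1)) F holds for every i < k, and ensures R (I k) Q F holds, then ensures R P Q F holds. -/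
universe u

variable {σ : Type u}

/-- If every state of `Q` eventually reaches `Q'`, then so does every state that eventually
reaches `Q`. -/
theorem EventuallyRel.trans {R : σ → σ → Prop} {Q Q' : Set σ} {s : σ}
    (h : EventuallyRel R Q s) (hQ : ∀ s' ∈ Q, EventuallyRel R Q' s') :
    EventuallyRel R Q' s := by
  induction h with
  | base hs => exact hQ _ hs
  | step hex _ ih => exact .step hex ih

theorem EventuallyRel.mono {R : σ → σ → Prop} {Q Q' : Set σ} {s : σ}
    (h : EventuallyRel R Q s) (hQ : Q ⊆ Q') : EventuallyRel R Q' s :=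
  h.trans fun _ hs => .base (hQ hs)

/-- Sequential composition of Hoare triples with a transitive frame. -/
theorem ensures.trans {R : σ → σ → Prop} {P Q S : Set σ} {F : Set (σ × σ)}
    (hF : ∀ s s' s'', (s, s') ∈ F → (s', s'') ∈ F → (s, s'') ∈ F)
    (hPQ : ensures R P Q F) (hQS : ensures R Q S F) : ensures R P S F :=
  fun s hs => EventuallyRel.trans (hPQ s hs) fun s' hs' =>
    EventuallyRel.mono (hQS s' hs'.1) fun s'' hs'' => ⟨hs''.1, hF s s' s'' hs'.2 hs''.2⟩

theorem ensures_loop (R : σ → σ → Prop) (P Q : Set σ) (F : Set (σ × σ))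
    (hF : ∀ s s' s'', (s, s') ∈ F → (s', s'') ∈ F → (s, s'') ∈ F)
    (I : ℕ → Set σ) (k : ℕ)
    (h0 : ensures R P (I 0) F)
    (hstep : ∀ i < k, ensures R (I i) (I (i + 1)) F)
    (hk : ensures R (I k) Q F) :
    ensures R P Q F := by
  have hI : ∀ i ≤ k, ensures R P (I i) F := by
    intro i
    induction i with
    | zero => exact fun _ => h0
    | succ i ih => exact fun hi => (ih (by omega)).trans hF (hstep i hi)
  exact (hI k le_rfl).trans hF hk
end
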